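/- Let X be a topological space that permits loop deletion. Then for every continuous map α : [0,1] → X there exists a loop-cancellation 𝒱 of α that is maximal in the partial order on loop-cancellations of α. -/

import Mathlib

/-- A space `X` permits loop deletion: for every path `α : [0,1] → X` and all
sequences `(aₙ)` nonincreasing to `0` and `(bₙ)` nondecreasing to `1` in `[0,1]`
with `a₀ < b₀` and `α (aₙ) = α (bₙ)` for all `n`, one has `α 0 = α 1`. -/
def PermitsLoopDeletion (X : Type*) [TopologicalSpace X] : Prop :=
  ∀ α : ℝ → X, ContinuousOn α (Set.Icc 0 1) →
    ∀ a b : ℕ → ℝ, (∀ n, a n ∈ Set.Icc (0 : ℝ) 1) → (∀ n, b n ∈ Set.Icc (0 : ℝ) 1) →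
      Antitone a → Monotone b → a 0 < b 0 →
      Filter.Tendsto a Filter.atTop (nhds 0) →
      Filter.Tendsto b Filter.atTop (nhds 1) →
      (∀ n : ℕ, α (a n) = α (b n)) → α 0 = α 1

/-- A loop-cancellation of a path `α : [0,1] → X`: a set of pairwise-disjoint
open intervals `(a,b) ⊆ [0,1]` (encoded by their endpoint pairs) such that
`α a = α b` for each interval. -/
def IsLoopCancellation {X : Type*} (α : ℝ → X) (U : Set (ℝ × ℝ)) : Prop :=
  (∀ p ∈ U, 0 ≤ p.1 ∧ p.1 < p.2 ∧ p.2 ≤ 1 ∧ α p.1 = α p.2) ∧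
  U.Pairwise fun p q => Disjoint (Set.Ioo p.1 p.2) (Set.Ioo q.1 q.2)

/-- The partial order on loop-cancellations: `U ≤ V` iff every interval of `U`
is contained in some interval of `V`. -/
def LCle (U V : Set (ℝ × ℝ)) : Prop :=
  ∀ p ∈ U, ∃ q ∈ V, Set.Ioo p.1 p.2 ⊆ Set.Ioo q.1 q.2

/-- `U` is a maximal loop-cancellation of `α`: any loop-cancellation above it
is also below it (hence equal to it). -/
def IsMaximalLoopCancellation {X : Type*} (α : ℝ → X) (U : Set (ℝ × ℝ)) : Prop :=
  IsLoopCancellation α U ∧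
    ∀ V : Set (ℝ × ℝ), IsLoopCancellation α V → LCle U V → LCle V U

/-- `PermitsLoopDeletion`, rescaled to an arbitrary interval `[c, d] ⊆ [0, 1]`. -/
theorem PermitsLoopDeletion.eq_of_tendsto {X : Type*} [TopologicalSpace X]
    (hX : PermitsLoopDeletion X) {α : ℝ → X} (hα : ContinuousOn α (Set.Icc 0 1))
    {c d : ℝ} (hc : 0 ≤ c) (hcd : c < d) (hd : d ≤ 1) {a b : ℕ → ℝ}
    (ha : Antitone a) (hb : Monotone b) (hab : ∀ n, a n < b n)
    (hca : ∀ n, c ≤ a n) (hbd : ∀ n, b n ≤ d)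
    (hac : Filter.Tendsto a Filter.atTop (nhds c))
    (hbd' : Filter.Tendsto b Filter.atTop (nhds d))
    (h : ∀ n, α (a n) = α (b n)) : α c = α d := by
  have hpos : 0 < d - c := sub_pos.2 hcd
  have hne : d - c ≠ 0 := hpos.ne'
  have key : ∀ x, c + (d - c) * ((x - c) / (d - c)) = x := fun x => by field_simp; ring
  have hmem : ∀ x, c ≤ x → x ≤ d → (x - c) / (d - c) ∈ Set.Icc (0 : ℝ) 1 := fun x h₁ h₂ =>
    ⟨div_nonneg (by linarith) hpos.le, (div_le_one hpos).2 (by linarith)⟩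
  have := hX (fun t => α (c + (d - c) * t))
    (hα.comp (by fun_prop) fun t ht => by
      constructor <;> nlinarith [ht.1, ht.2])
    (fun n => (a n - c) / (d - c)) (fun n => (b n - c) / (d - c))
    (fun n => hmem _ (hca n) ((hab n).le.trans (hbd n)))
    (fun n => hmem _ ((hca n).trans (hab n).le) (hbd n))
    (fun i j hij => div_le_div_of_nonneg_right (sub_le_sub_right (ha hij) c) hpos.le)
    (fun i j hij => div_le_div_of_nonneg_right (sub_le_sub_right (hb hij) c) hpos.le)
    (div_lt_div_of_pos_right (sub_lt_sub_right (hab 0) c) hpos)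
    (by simpa using (hac.sub_const c).div_const (d - c))
    (by simpa [div_self hne] using (hbd'.sub_const c).div_const (d - c))
    (fun n => by simpa only [key] using h n)
  simpa using this

/-- The interval `(p.1, p.2)` is nested in `(q.1, q.2)`, on endpoint pairs. -/
def EndpointLE (p q : ℝ × ℝ) : Prop := q.1 ≤ p.1 ∧ p.2 ≤ q.2

theorem EndpointLE.refl (p : ℝ × ℝ) : EndpointLE p p := ⟨le_rfl, le_rfl⟩

theorem EndpointLE.trans {p q r : ℝ × ℝ} (h : EndpointLE p q) (h' : EndpointLE q r) :
    EndpointLE p r := ⟨h'.1.trans h.1, h.2.trans h'.2⟩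

theorem endpointLE_of_Ioo_subset {p q : ℝ × ℝ} (hp : p.1 < p.2)
    (h : Set.Ioo p.1 p.2 ⊆ Set.Ioo q.1 q.2) : EndpointLE p q :=
  (Set.Ioo_subset_Ioo_iff hp).1 h

/-- A family of subintervals of `[0, 1]`, totally ordered by inclusion, whose endpoints have
equal `α`-values has a union with the same property. -/
theorem PermitsLoopDeletion.apply_sInf_eq_apply_sSup {X : Type*} [TopologicalSpace X]
    (hX : PermitsLoopDeletion X) {α : ℝ → X} (hα : ContinuousOn α (Set.Icc 0 1))
    {T : Set (ℝ × ℝ)} (hT : ∀ p ∈ T, 0 ≤ p.1 ∧ p.1 < p.2 ∧ p.2 ≤ 1 ∧ α p.1 = α p.2)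
    (hne : T.Nonempty) (htot : ∀ p ∈ T, ∀ q ∈ T, EndpointLE p q ∨ EndpointLE q p) :
    α (sInf (Prod.fst '' T)) = α (sSup (Prod.snd '' T)) := by
  have hbelow : BddBelow (Prod.fst '' T) := ⟨0, by rintro _ ⟨p, hp, rfl⟩; exact (hT p hp).1⟩
  have habove : BddAbove (Prod.snd '' T) :=
    ⟨1, by rintro _ ⟨p, hp, rfl⟩; exact (hT p hp).2.2.1⟩
  have hlo : ∀ p ∈ T, sInf (Prod.fst '' T) ≤ p.1 := fun p hp => csInf_le hbelow ⟨p, hp, rfl⟩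
  have hhi : ∀ p ∈ T, p.2 ≤ sSup (Prod.snd '' T) := fun p hp => le_csSup habove ⟨p, hp, rfl⟩
  have hdir : ∀ p ∈ T, ∀ q ∈ T, ∃ r ∈ T, EndpointLE p r ∧ EndpointLE q r := fun p hp q hq =>
    (htot p hp q hq).elim (fun h => ⟨q, hq, h, .refl q⟩) (fun h => ⟨p, hp, .refl p, h⟩)
  obtain ⟨u, -, hu, huT⟩ := exists_seq_tendsto_sInf (hne.image Prod.fst) hbelow
  obtain ⟨v, -, hv, hvT⟩ := exists_seq_tendsto_sSup (hne.image Prod.snd) habove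
  have hnext : ∀ (n : ℕ) (p : T), ∃ r : T, EndpointLE p r ∧ r.1.1 ≤ u n ∧ v n ≤ r.1.2 := by
    rintro n ⟨p, hp⟩
    obtain ⟨q, hq, hqu⟩ := huT n
    obtain ⟨r, hr, hrv⟩ := hvT n
    obtain ⟨s, hs, hps, hqs⟩ := hdir p hp q hq
    obtain ⟨t, ht, hst, hrt⟩ := hdir s hs r hr
    exact ⟨⟨t, ht⟩, hps.trans hst, hqu ▸ (hqs.trans hst).1, hrv ▸ hrt.2⟩
  choose f hf hfu hfv using hnext
  obtain ⟨p₀, hp₀⟩ := hne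
  let g : ℕ → T := fun n => Nat.rec ⟨p₀, hp₀⟩ f n
  let m : ℕ → T := fun n => g (n + 1)
  have hm : ∀ n, EndpointLE (m n) (m (n + 1)) := fun n => hf (n + 1) (m n)
  have hmT : ∀ n, (m n).1 ∈ T := fun n => (m n).2
  have hlt := (hlo p₀ hp₀).trans_lt ((hT p₀ hp₀).2.1.trans_le (hhi p₀ hp₀))
  refine hX.eq_of_tendsto hα (a := fun n => (m n).1.1) (b := fun n => (m n).1.2)
    (le_csInf ⟨p₀.1, p₀, hp₀, rfl⟩ ?_) hlt (csSup_le ⟨p₀.2, p₀, hp₀, rfl⟩ ?_)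
    (antitone_nat_of_succ_le fun n => (hm n).1) (monotone_nat_of_le_succ fun n => (hm n).2)
    (fun n => (hT _ (hmT n)).2.1) (fun n => hlo _ (hmT n)) (fun n => hhi _ (hmT n))
    (tendsto_of_tendsto_of_tendsto_of_le_of_le tendsto_const_nhds hu
      (fun n => hlo _ (hmT n)) fun n => hfu n (g n))
    (tendsto_of_tendsto_of_tendsto_of_le_of_le hv tendsto_const_nhds
      (fun n => hfv n (g n)) fun n => hhi _ (hmT n))
    (fun n => (hT _ (hmT n)).2.2.2)
  · rintro _ ⟨p, hp, rfl⟩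
    exact (hT p hp).1
  · rintro _ ⟨p, hp, rfl⟩
    exact (hT p hp).2.2.1

/-- Endpoints of the union of all intervals of `S` containing the interval `p`. -/
noncomputable def hullIn (S : Set (ℝ × ℝ)) (p : ℝ × ℝ) : ℝ × ℝ :=
  (sInf (Prod.fst '' {q ∈ S | EndpointLE p q}), sSup (Prod.snd '' {q ∈ S | EndpointLE p q}))

section Hull

variable {S : Set (ℝ × ℝ)}

theorem hullIn_endpointLE (hS : ∀ p ∈ S, 0 ≤ p.1 ∧ p.2 ≤ 1) {p q : ℝ × ℝ} (hq : q ∈ S)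
    (hpq : EndpointLE p q) : EndpointLE q (hullIn S p) := by
  refine ⟨csInf_le ⟨0, ?_⟩ ⟨q, ⟨hq, hpq⟩, rfl⟩, le_csSup ⟨1, ?_⟩ ⟨q, ⟨hq, hpq⟩, rfl⟩⟩
  · rintro _ ⟨r, hr, rfl⟩
    exact (hS r hr.1).1
  · rintro _ ⟨r, hr, rfl⟩
    exact (hS r hr.1).2

theorem endpointLE_hullIn {p r : ℝ × ℝ} (hp : p ∈ S)
    (h : ∀ q ∈ S, EndpointLE p q → EndpointLE q r) : EndpointLE (hullIn S p) r := by
  refine ⟨le_csInf ⟨p.1, p, ⟨hp, .refl p⟩, rfl⟩ ?_, csSup_le ⟨p.2, p, ⟨hp, .refl p⟩, rfl⟩ ?_⟩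
  · rintro _ ⟨q, hq, rfl⟩
    exact (h q hq.1 hq.2).1
  · rintro _ ⟨q, hq, rfl⟩
    exact (h q hq.1 hq.2).2

variable (hS : ∀ p ∈ S, 0 ≤ p.1 ∧ p.1 < p.2 ∧ p.2 ≤ 1)
  (hnest : ∀ p ∈ S, ∀ q ∈ S, ∀ x, x ∈ Set.Ioo p.1 p.2 → x ∈ Set.Ioo q.1 q.2 →
    EndpointLE p q ∨ EndpointLE q p)

include hS hnest

theorem endpointLE_total_of_endpointLE {p q r : ℝ × ℝ} (hp : p ∈ S) (hq : q ∈ S) (hr : r ∈ S)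
    (hpq : EndpointLE p q) (hpr : EndpointLE p r) : EndpointLE q r ∨ EndpointLE r q := by
  obtain ⟨x, hx₁, hx₂⟩ := exists_between (hS p hp).2.1
  exact hnest q hq r hr x ⟨hpq.1.trans_lt hx₁, hx₂.trans_le hpq.2⟩
    ⟨hpr.1.trans_lt hx₁, hx₂.trans_le hpr.2⟩

theorem hullIn_eq_of_endpointLE {p q : ℝ × ℝ} (hp : p ∈ S) (hq : q ∈ S)
    (hpq : EndpointLE p q) : hullIn S p = hullIn S q := by
  have hb : ∀ p ∈ S, 0 ≤ p.1 ∧ p.2 ≤ 1 := fun p hp => ⟨(hS p hp).1, (hS p hp).2.2⟩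
  have h₁ : EndpointLE (hullIn S p) (hullIn S q) := endpointLE_hullIn hp fun r hr hpr =>
    (endpointLE_total_of_endpointLE hS hnest hp hq hr hpq hpr).elim
      (fun h => hullIn_endpointLE hb hr h)
      (fun h => h.trans (hullIn_endpointLE hb hq (.refl q)))
  have h₂ : EndpointLE (hullIn S q) (hullIn S p) := endpointLE_hullIn hq fun r hr hqr =>
    hullIn_endpointLE hb hr (hpq.trans hqr)
  exact Prod.ext (h₂.1.antisymm h₁.1) (h₁.2.antisymm h₂.2)

theorem exists_mem_Ioo_of_mem_hullIn {p : ℝ × ℝ} (hp : p ∈ S) {x : ℝ}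
    (hx : x ∈ Set.Ioo (hullIn S p).1 (hullIn S p).2) :
    ∃ q ∈ S, EndpointLE p q ∧ x ∈ Set.Ioo q.1 q.2 := by
  have hne : {q ∈ S | EndpointLE p q}.Nonempty := ⟨p, hp, .refl p⟩
  obtain ⟨_, ⟨q, ⟨hq, hpq⟩, rfl⟩, hqx⟩ :=
    exists_lt_of_csInf_lt (hne.image _) hx.1
  obtain ⟨_, ⟨r, ⟨hr, hpr⟩, rfl⟩, hrx⟩ :=
    exists_lt_of_lt_csSup (hne.image _) hx.2
  rcases endpointLE_total_of_endpointLE hS hnest hp hq hr hpq hpr with h | h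
  · exact ⟨r, hr, hpr, h.1.trans_lt hqx, hrx⟩
  · exact ⟨q, hq, hpq, hqx, hrx.trans_le h.2⟩

theorem hullIn_eq_of_not_disjoint {p q : ℝ × ℝ} (hp : p ∈ S) (hq : q ∈ S)
    (h : ¬Disjoint (Set.Ioo (hullIn S p).1 (hullIn S p).2)
      (Set.Ioo (hullIn S q).1 (hullIn S q).2)) : hullIn S p = hullIn S q := by
  obtain ⟨x, hxp, hxq⟩ := Set.not_disjoint_iff.1 h
  obtain ⟨p', hp', hpp', hx⟩ := exists_mem_Ioo_of_mem_hullIn hS hnest hp hxp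
  obtain ⟨q', hq', hqq', hx'⟩ := exists_mem_Ioo_of_mem_hullIn hS hnest hq hxq
  rw [hullIn_eq_of_endpointLE hS hnest hp hp' hpp', hullIn_eq_of_endpointLE hS hnest hq hq' hqq']
  rcases hnest p' hp' q' hq' x hx hx' with h | h
  · exact hullIn_eq_of_endpointLE hS hnest hp' hq' h
  · exact (hullIn_eq_of_endpointLE hS hnest hq' hp' h).symm

end Hull

theorem LCle.trans {U V W : Set (ℝ × ℝ)} (h : LCle U V) (h' : LCle V W) : LCle U W := by
  intro p hp
  obtain ⟨q, hq, hpq⟩ := h p hp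
  obtain ⟨r, hr, hqr⟩ := h' q hq
  exact ⟨r, hr, hpq.trans hqr⟩

/-- If two intervals of comparable loop-cancellations meet, the one in the smaller cancellation is
nested in the other. -/
theorem LCle.endpointLE {X : Type*} {α : ℝ → X} {U V : Set (ℝ × ℝ)} (h : LCle U V)
    (hU : IsLoopCancellation α U) (hV : IsLoopCancellation α V) {p q : ℝ × ℝ} (hp : p ∈ U)
    (hq : q ∈ V) {x : ℝ} (hxp : x ∈ Set.Ioo p.1 p.2) (hxq : x ∈ Set.Ioo q.1 q.2) :
    EndpointLE p q := by
  obtain ⟨r, hr, hpr⟩ := h p hp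
  obtain rfl : r = q := hV.2.eq hr hq (Set.not_disjoint_iff.2 ⟨x, hpr hxp, hxq⟩)
  exact endpointLE_of_Ioo_subset (hU.1 p hp).2.1 hpr

/-- If `X` permits loop deletion, every chain of loop-cancellations has an upper bound. -/
theorem PermitsLoopDeletion.exists_upperBound_of_isChain {X : Type*} [TopologicalSpace X]
    (hX : PermitsLoopDeletion X) {α : ℝ → X} (hα : ContinuousOn α (Set.Icc 0 1))
    {C : Set (Set (ℝ × ℝ))} (hC : ∀ U ∈ C, IsLoopCancellation α U)
    (hchain : ∀ U ∈ C, ∀ V ∈ C, LCle U V ∨ LCle V U) :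
    ∃ W, IsLoopCancellation α W ∧ ∀ U ∈ C, LCle U W := by
  have hS : ∀ p ∈ ⋃₀ C, 0 ≤ p.1 ∧ p.1 < p.2 ∧ p.2 ≤ 1 ∧ α p.1 = α p.2 := by
    rintro p ⟨U, hU, hp⟩
    exact (hC U hU).1 p hp
  have hS' : ∀ p ∈ ⋃₀ C, 0 ≤ p.1 ∧ p.1 < p.2 ∧ p.2 ≤ 1 := fun p hp =>
    ⟨(hS p hp).1, (hS p hp).2.1, (hS p hp).2.2.1⟩
  have hb : ∀ p ∈ ⋃₀ C, 0 ≤ p.1 ∧ p.2 ≤ 1 := fun p hp => ⟨(hS p hp).1, (hS p hp).2.2.1⟩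
  have hnest : ∀ p ∈ ⋃₀ C, ∀ q ∈ ⋃₀ C, ∀ x, x ∈ Set.Ioo p.1 p.2 → x ∈ Set.Ioo q.1 q.2 →
      EndpointLE p q ∨ EndpointLE q p := by
    rintro p ⟨U, hU, hp⟩ q ⟨V, hV, hq⟩ x hxp hxq
    exact (hchain U hU V hV).imp
      (fun h => h.endpointLE (hC U hU) (hC V hV) hp hq hxp hxq)
      (fun h => h.endpointLE (hC V hV) (hC U hU) hq hp hxq hxp)
  refine ⟨hullIn (⋃₀ C) '' ⋃₀ C, ⟨?_, ?_⟩, fun U hU p hp => ?_⟩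
  · rintro _ ⟨p, hp, rfl⟩
    have hle := hullIn_endpointLE hb hp (.refl p)
    have hge : EndpointLE (hullIn (⋃₀ C) p) (0, 1) := endpointLE_hullIn hp fun q hq _ => hb q hq
    exact ⟨hge.1, hle.1.trans_lt ((hS p hp).2.1.trans_le hle.2), hge.2,
      hX.apply_sInf_eq_apply_sSup hα (fun q hq => hS q hq.1) ⟨p, hp, .refl p⟩
        fun q hq r hr => endpointLE_total_of_endpointLE hS' hnest hp hq.1 hr.1 hq.2 hr.2⟩
  · rintro _ ⟨p, hp, rfl⟩ _ ⟨q, hq, rfl⟩ hpq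
    by_contra h
    exact hpq (hullIn_eq_of_not_disjoint hS' hnest hp hq h)
  · have hp' : p ∈ ⋃₀ C := ⟨U, hU, hp⟩
    have hle := hullIn_endpointLE hb hp' (.refl p)
    exact ⟨_, ⟨p, hp', rfl⟩, Set.Ioo_subset_Ioo hle.1 hle.2⟩

/-- If `X` permits loop deletion, then every path in `X` admits a maximal
loop-cancellation. -/
theorem exists_maximal_loopCancellation
    {X : Type*} [TopologicalSpace X] (hX : PermitsLoopDeletion X)
    (α : ℝ → X) (hα : ContinuousOn α (Set.Icc 0 1)) :
    ∃ V : Set (ℝ × ℝ), IsMaximalLoopCancellation α V := by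
  obtain ⟨m, hm⟩ := exists_maximal_of_chains_bounded
    (r := fun U V : {U : Set (ℝ × ℝ) // IsLoopCancellation α U} => LCle U V)
    (fun c hc => by
      obtain ⟨W, hW, hle⟩ := hX.exists_upperBound_of_isChain hα (C := Subtype.val '' c)
        (by rintro _ ⟨U, -, rfl⟩; exact U.2)
        (by
          rintro _ ⟨U, hU, rfl⟩ _ ⟨V, hV, rfl⟩
          by_cases h : U = V
          · exact Or.inl fun p hp => ⟨p, h ▸ hp, subset_rfl⟩
          · exact hc hU hV h)
      exact ⟨⟨W, hW⟩, fun U hU => hle U ⟨U, hU, rfl⟩⟩)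
    (fun h h' => LCle.trans h h')
  exact ⟨m, m.2, fun V hV h => hm ⟨V, hV⟩ h⟩
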